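/- For every integer q ≥ 2 and all integers N ≥ 0 and M ≥ 0, the limit I(Z_3, q) = lim_{n→∞} II_n(Z_3, q) satisfies ∑_{ℓ=1}^{N} a_ℓ · ∑_{i=0}^{2M+1} (G_ℓ(i) + H_ℓ(i)) ≤ I(Z_3, q) ≤ q^{−N} + ∑_{ℓ=1}^{N} a_ℓ · ∑_{i=0}^{2M} (G_ℓ(i) + H_ℓ(i)). -/

import Mathlib

/-- `V` is a bifix of `W`: `V` is nonempty and is both a proper prefix
and a proper suffix of `W`. -/
def IsBifix {α : Type*} (V W : List α) : Prop :=
  V ≠ [] ∧ (∃ A, A ≠ [] ∧ W = V ++ A) ∧ (∃ B, B ≠ [] ∧ W = B ++ V)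

/-- A word is bifix-free if it has no bifix. -/
def BifixFree {α : Type*} (W : List α) : Prop := ∀ V, ¬ IsBifix V W

/-- `aCount q ℓ` is the number of bifix-free words of length `ℓ` over a `q`-letter
alphabet, with the convention `aCount q 0 = 0`. -/
noncomputable def aCount (q ℓ : ℕ) : ℕ :=
  if ℓ = 0 then 0 else Nat.card {W : List (Fin q) // W.length = ℓ ∧ BifixFree W}

/-- A word is a `Z₃`-instance if it has the form `ABACABA` with `A, B, C` nonempty. -/
def Z3Instance {α : Type*} (W : List α) : Prop :=
  ∃ A B C : List α, A ≠ [] ∧ B ≠ [] ∧ C ≠ [] ∧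
    W = A ++ B ++ A ++ C ++ A ++ B ++ A

/-- `instProb3 q n` is the probability that a uniformly random word of length `n`
over a `q`-letter alphabet is a `Z₃`-instance. -/
noncomputable def instProb3 (q n : ℕ) : ℝ :=
  (Nat.card {W : List (Fin q) // W.length = n ∧ Z3Instance W} : ℝ) / (q : ℝ) ^ n

/-- `r(x) = qx^{2ℓ+1} − x^{4ℓ} + x^{5ℓ} − qx^{5ℓ+1} + x^{6ℓ}`. -/
noncomputable def rPoly (q ℓ : ℕ) (x : ℝ) : ℝ :=
  q * x ^ (2 * (ℓ : ℤ) + 1) - x ^ (4 * (ℓ : ℤ)) + x ^ (5 * (ℓ : ℤ)) -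
    q * x ^ (5 * (ℓ : ℤ) + 1) + x ^ (6 * (ℓ : ℤ))

/-- `s(x) = 1 − qx^{1−ℓ} + x^{−ℓ}`. -/
noncomputable def sPoly (q ℓ : ℕ) (x : ℝ) : ℝ :=
  1 - q * x ^ (1 - (ℓ : ℤ)) + x ^ (-(ℓ : ℤ))

/-- `u(x) = qx^{4ℓ+1} − x^{5ℓ} + qx^{5ℓ+1} − x^{6ℓ}`. -/
noncomputable def uPoly (q ℓ : ℕ) (x : ℝ) : ℝ :=
  q * x ^ (4 * (ℓ : ℤ) + 1) - x ^ (5 * (ℓ : ℤ)) + q * x ^ (5 * (ℓ : ℤ) + 1) -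
    x ^ (6 * (ℓ : ℤ))

/-- `v(x) = 1 − qx^{1−ℓ} + x^{−ℓ} − qx^{1−2ℓ} + x^{−2ℓ}`. -/
noncomputable def vPoly (q ℓ : ℕ) (x : ℝ) : ℝ :=
  1 - q * x ^ (1 - (ℓ : ℤ)) + x ^ (-(ℓ : ℤ)) - q * x ^ (1 - 2 * (ℓ : ℤ)) +
    x ^ (-(2 * (ℓ : ℤ)))

/-- `G_ℓ(i) = (−1)^i r(q^{−2^{i+1}}) ∏_{j=0}^{i−1} s(q^{−2^{j+1}})
  / ∏_{k=0}^{i} (1 − q^{1−2^{k+1}})`. -/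
noncomputable def Gterm (q ℓ i : ℕ) : ℝ :=
  (-1 : ℝ) ^ i * rPoly q ℓ ((q : ℝ) ^ (-(2 : ℤ) ^ (i + 1))) *
      (∏ j ∈ Finset.range i, sPoly q ℓ ((q : ℝ) ^ (-(2 : ℤ) ^ (j + 1)))) /
    ∏ k ∈ Finset.range (i + 1), (1 - (q : ℝ) ^ ((1 : ℤ) - 2 ^ (k + 1)))

/-- `H_ℓ(i) = (−1)^i u(q^{−2^{i+1}}) ∏_{j=0}^{i−1} v(q^{−2^{j+1}})
  / ∏_{k=0}^{i} (1 − q^{1−2^{k+1}})`. -/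
noncomputable def Hterm (q ℓ i : ℕ) : ℝ :=
  (-1 : ℝ) ^ i * uPoly q ℓ ((q : ℝ) ^ (-(2 : ℤ) ^ (i + 1))) *
      (∏ j ∈ Finset.range i, vPoly q ℓ ((q : ℝ) ^ (-(2 : ℤ) ^ (j + 1)))) /
    ∏ k ∈ Finset.range (i + 1), (1 - (q : ℝ) ^ ((1 : ℤ) - 2 ^ (k + 1)))


open scoped ENNReal

section Border

variable {α : Type*}

/-- `U` is both a prefix and a suffix of `V` (possibly `U = V`). -/
def Border (U V : List α) : Prop := U <+: V ∧ U <:+ V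

theorem Border.refl (U : List α) : Border U U := ⟨List.prefix_refl U, List.suffix_refl U⟩

theorem Border.trans {U V W : List α} (h : Border U V) (h' : Border V W) : Border U W :=
  ⟨h.1.trans h'.1, h.2.trans h'.2⟩

theorem Border.length_le {U V : List α} (h : Border U V) : U.length ≤ V.length :=
  h.1.length_le

theorem Border.eq_of_length_le {U V : List α} (h : Border U V) (hl : V.length ≤ U.length) :
    U = V :=
  h.1.eq_of_length_le hl

theorem Border.of_length_le {U V W : List α} (h : Border U W) (h' : Border V W)
    (hl : U.length ≤ V.length) : Border U V :=
  ⟨List.prefix_of_prefix_length_le h.1 h'.1 hl, List.suffix_of_suffix_length_le h.2 h'.2 hl⟩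

theorem Border.append_append (U C : List α) : Border U (U ++ C ++ U) :=
  ⟨⟨C ++ U, by simp⟩, ⟨U ++ C, rfl⟩⟩

theorem Border.append_self (U : List α) : Border U (U ++ U) :=
  ⟨⟨U, rfl⟩, ⟨U, rfl⟩⟩

theorem Border.exists_eq_append {U V : List α} (h : Border U V)
    (hl : 2 * U.length ≤ V.length) : ∃ C, V = U ++ C ++ U := by
  obtain ⟨⟨A, rfl⟩, D, hD⟩ := h
  have : U <:+ A := List.suffix_of_suffix_length_le (l₃ := U ++ A) ⟨D, hD⟩ ⟨U, rfl⟩ (by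
    rw [List.length_append] at hl; omega)
  obtain ⟨C, rfl⟩ := this
  exact ⟨C, by simp⟩

theorem Border.exists_overlap {U V : List α} (h : Border U V)
    (hl : V.length < 2 * U.length) :
    ∃ B, B ≠ [] ∧ Border B U ∧ V = U ++ U.drop B.length := by
  obtain ⟨⟨A, rfl⟩, D, hD⟩ := h
  rw [List.length_append] at hl
  have hDA : D.length = A.length := by
    have := congrArg List.length hD
    simp only [List.length_append] at this
    omega
  have hDU : D <+: U := List.prefix_of_prefix_length_le (l₃ := U ++ A)
    ⟨U, hD⟩ ⟨A, rfl⟩ (by omega)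
  obtain ⟨B, hB⟩ := hDU
  have hBA : U = B ++ A := by
    rw [← hB, List.append_assoc] at hD
    rw [← List.append_cancel_left hD, hB]
  refine ⟨B, ?_, ⟨⟨A, hBA.symm⟩, ⟨D, hB⟩⟩, ?_⟩
  · rintro rfl
    have := congrArg List.length hBA
    simp only [List.nil_append] at this
    omega
  · congr 1
    conv_rhs => rw [hBA]
    simp

theorem Border.append_drop {B U : List α} (h : Border B U) :
    Border U (U ++ U.drop B.length) := by
  obtain ⟨⟨A, hA⟩, D, hD⟩ := h
  refine ⟨⟨_, rfl⟩, D, ?_⟩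
  have : U.drop B.length = A := by rw [← hA]; simp
  rw [this]
  conv_lhs => rw [← hA]
  rw [← List.append_assoc, hD]

/-- The words satisfying `P` none of whose bifixes satisfies `P`. -/
def borderMin (P : List α → Prop) : Set (List α) :=
  {U | P U ∧ ∀ B, P B → Border B U → B = U}

theorem exists_borderMin {P : List α → Prop} {V : List α} (h : P V) :
    ∃ U ∈ borderMin P, Border U V := by
  classical
  have hex : ∃ n, ∃ U, P U ∧ Border U V ∧ U.length = n := ⟨_, V, h, Border.refl V, rfl⟩
  obtain ⟨U, hU, hUV, hn⟩ := Nat.find_spec hex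
  refine ⟨U, ⟨hU, fun B hB hBU => hBU.eq_of_length_le ?_⟩, hUV⟩
  rw [hn]
  exact Nat.find_min' hex ⟨B, hB, hBU.trans hUV, rfl⟩

theorem borderMin_unique {P : List α → Prop} {U U' W : List α} (h : U ∈ borderMin P)
    (h' : U' ∈ borderMin P) (hW : Border U W) (hW' : Border U' W) : U = U' := by
  rcases le_total U.length U'.length with hl | hl
  · exact h'.2 U h.1 (hW.of_length_le hW' hl)
  · exact (h.2 U' h'.1 (hW'.of_length_le hW hl)).symm

theorem mem_borderMin_ne_nil {L : List α} :
    L ∈ borderMin (fun V : List α => V ≠ []) ↔ L ≠ [] ∧ BifixFree L := by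
  refine and_congr_right fun _ => ⟨fun h V hV => ?_, fun h B hB hBL => ?_⟩
  · obtain ⟨hV0, ⟨A, hA, rfl⟩, B, -, hB⟩ := hV
    have := h V hV0 ⟨⟨A, rfl⟩, ⟨B, hB.symm⟩⟩
    exact hA (by simpa using this)
  · by_contra hne
    obtain ⟨⟨A, hA⟩, D, hD⟩ := hBL
    refine h B ⟨hB, ⟨A, ?_, hA.symm⟩, D, ?_, hD.symm⟩
    · rintro rfl
      exact hne (by simpa using hA)
    · rintro rfl
      exact hne (by simpa using hD)

/-- `K` is a border of a word of length greater than `m`. -/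
def LongBorder (K : List α) (m : ℕ) (V : List α) : Prop := Border K V ∧ m < V.length

theorem LongBorder.mono {K U V : List α} {m : ℕ} (h : LongBorder K m U) (hUV : Border U V) :
    LongBorder K m V :=
  ⟨h.1.trans hUV, h.2.trans_le hUV.length_le⟩

variable {L : List α}

theorem border_of_ne_nil (hL : L ∈ borderMin (fun V : List α => V ≠ [])) {B U : List α}
    (hB : B ≠ []) (hBU : Border B U) (hLU : Border L U) : Border L B := by
  rcases le_total L.length B.length with hl | hl
  · exact hLU.of_length_le hBU hl
  · rw [hL.2 B hB (hBU.of_length_le hLU hl)]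
    exact Border.refl _

theorem eq_or_eq_append_self (hL : L ∈ borderMin (fun V : List α => V ≠ [])) {B : List α}
    (h : Border L B) (hl : B.length ≤ 2 * L.length) : B = L ∨ B = L ++ L := by
  rcases hl.lt_or_eq with hl | hl
  · obtain ⟨C, hC, hCL, rfl⟩ := h.exists_overlap hl
    left
    rw [hL.2 C hC hCL]
    simp
  · obtain ⟨C, rfl⟩ := h.exists_eq_append hl.ge
    right
    have : C = [] := List.length_eq_zero_iff.1 (by
      simp only [List.length_append] at hl; omega)
    simp [this]

theorem mem_borderMin_append_self
    {U : List α} :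
    U ∈ borderMin (LongBorder (L ++ L) (2 * L.length)) ↔
      U ∈ borderMin (LongBorder L (2 * L.length)) ∧ Border (L ++ L) U := by
  constructor
  · rintro ⟨hU, h⟩
    refine ⟨⟨⟨(Border.append_self L).trans hU.1, hU.2⟩, fun B hB hBU => h B ⟨?_, hB.2⟩ hBU⟩, hU.1⟩
    exact hU.1.of_length_le hBU (by have := hB.2; simp only [List.length_append]; omega)
  · rintro ⟨⟨hU, h⟩, hLU⟩
    exact ⟨⟨hLU, hU.2⟩, fun B hB hBU => h B ⟨(Border.append_self L).trans hB.1, hB.2⟩ hBU⟩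

theorem setOf_border_append_self (hL : L ∈ borderMin (fun V : List α => V ≠ [])) :
    {B : List α | B ≠ [] ∧ Border B (L ++ L)} = {L, L ++ L} := by
  ext B
  constructor
  · rintro ⟨hB, h⟩
    exact eq_or_eq_append_self hL (border_of_ne_nil hL hB h (Border.append_self L))
      (by have := h.length_le; simp only [List.length_append] at this; omega)
  · rintro (rfl | rfl)
    · exact ⟨hL.1, Border.append_self _⟩
    · exact ⟨by simpa using hL.1, Border.refl _⟩

open Classical in
theorem setOf_border_of_mem_borderMin (hL : L ∈ borderMin (fun V : List α => V ≠ []))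
    {U : List α} (hU : U ∈ borderMin (LongBorder L (2 * L.length))) :
    {B : List α | B ≠ [] ∧ Border B U} =
      {U, L} ∪ (if Border (L ++ L) U then {L ++ L} else ∅) := by
  have hU0 : U ≠ [] := by
    rintro rfl
    simpa using hU.1.2
  ext B
  constructor
  · rintro ⟨hB, h⟩
    have hLB := border_of_ne_nil hL hB h hU.1.1
    rcases le_or_gt B.length (2 * L.length) with hl | hl
    · rcases eq_or_eq_append_self hL hLB hl with rfl | rfl
      · simp
      · simp [h]
    · simp [hU.2 B ⟨hLB, hl⟩ h]
  · rintro ((rfl | rfl) | h)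
    · exact ⟨hU0, Border.refl _⟩
    · exact ⟨hL.1, hU.1.1⟩
    · split_ifs at h with hLU
      · obtain rfl : B = L ++ L := h
        exact ⟨by simpa using hL.1, hLU⟩
      · exact h.elim

theorem append_append_mem_borderMin (hL : L ∈ borderMin (fun V : List α => V ≠ [])) :
    L ++ L ++ L ∈ borderMin (LongBorder (L ++ L) (2 * L.length)) := by
  have hl0 : 0 < L.length := List.length_pos_iff.2 hL.1
  refine ⟨⟨⟨⟨L, rfl⟩, ⟨L, by simp⟩⟩, by simp only [List.length_append]; omega⟩, ?_⟩
  rintro B ⟨hB, hl⟩ hBL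
  have hle := hBL.length_le
  obtain ⟨C, hC, hCL, rfl⟩ := hB.exists_overlap (by
    simp only [List.length_append] at hle ⊢; omega)
  have hC' : C ∈ {B : List α | B ≠ [] ∧ Border B (L ++ L)} := ⟨hC, hCL⟩
  rw [setOf_border_append_self hL] at hC'
  rcases hC' with rfl | rfl
  · simp
  · simp at hl; omega

theorem z3Instance_iff {W : List α} :
    Z3Instance W ↔ ∃ L ∈ borderMin (fun V : List α => V ≠ []),
      ∃ V ∈ borderMin (LongBorder L (2 * L.length)), ∃ C, C ≠ [] ∧ W = V ++ C ++ V := by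
  constructor
  · rintro ⟨A, B, C, hA, hB, hC, rfl⟩
    obtain ⟨L, hL, hLA⟩ := exists_borderMin (P := fun V : List α => V ≠ []) hA
    have hBl := List.length_pos_iff.2 hB
    have hCl := List.length_pos_iff.2 hC
    have hV0 : LongBorder L (2 * L.length) (A ++ B ++ A) :=
      ⟨hLA.trans (Border.append_append A B), by
        have := hLA.length_le
        simp only [List.length_append]; omega⟩
    obtain ⟨V, hV, hVA⟩ := exists_borderMin hV0
    have hVW := hVA.trans (Border.append_append (A ++ B ++ A) C)
    have hle := hVA.length_le
    simp only [List.length_append] at hle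
    obtain ⟨D, hD⟩ := hVW.exists_eq_append (by simp only [List.length_append]; omega)
    refine ⟨L, hL, V, hV, D, ?_, by rw [← hD]; simp⟩
    rintro rfl
    have := congrArg List.length hD
    simp only [List.length_append, List.length_nil] at this
    omega
  · rintro ⟨L, hL, V, hV, C, hC, rfl⟩
    obtain ⟨X, rfl⟩ := hV.1.1.exists_eq_append hV.1.2.le
    refine ⟨L, X, C, hL.1, ?_, hC, by simp⟩
    rintro rfl
    have := hV.1.2
    simp only [List.length_append, List.length_nil] at this
    omega

end Border

section Weight

variable {α : Type*} {x : ℝ≥0∞}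

/-- The generating function `∑ x ^ |V|` over the words `V` in `S`. -/
noncomputable def wordWeight (x : ℝ≥0∞) (S : Set (List α)) : ℝ≥0∞ :=
  ∑' V : S, x ^ V.1.length

theorem wordWeight_mono {S T : Set (List α)} (h : S ⊆ T) : wordWeight x S ≤ wordWeight x T :=
  ENNReal.tsum_mono_subtype (fun V : List α => x ^ V.length) h

theorem wordWeight_singleton (V : List α) : wordWeight x {V} = x ^ V.length :=
  tsum_singleton V fun V : List α => x ^ V.length

theorem wordWeight_union {S T : Set (List α)} (h : Disjoint S T) :
    wordWeight x (S ∪ T) = wordWeight x S + wordWeight x T :=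
  ENNReal.summable.tsum_union_disjoint (f := fun V : List α => x ^ V.length) h ENNReal.summable

theorem wordWeight_setOf_border (U : List α) :
    wordWeight x {V | Border U V} =
      x ^ (2 * U.length) * wordWeight x (Set.univ : Set (List α)) +
        ∑' B : {B : List α | B ≠ [] ∧ Border B U}, x ^ (2 * U.length - B.1.length) := by
  have hsplit : {V | Border U V} = {V | Border U V ∧ 2 * U.length ≤ V.length} ∪
      {V | Border U V ∧ V.length < 2 * U.length} := by
    ext V
    simp only [Set.mem_ofPred_eq, Set.mem_union, ← and_or_left, le_or_gt, and_true]
  rw [hsplit, wordWeight_union]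
  · congr 1
    · rw [wordWeight, wordWeight, tsum_univ (fun V : List α => x ^ V.length),
        ← ENNReal.tsum_mul_left]
      let e : List α → {V | Border U V ∧ 2 * U.length ≤ V.length} := fun C =>
        ⟨U ++ C ++ U, Border.append_append U C, by simp only [List.length_append]; omega⟩
      have he : e.Bijective := by
        constructor
        · intro C D h
          have := congrArg Subtype.val h
          simpa [e] using this
        · rintro ⟨V, hV, hl⟩
          obtain ⟨C, rfl⟩ := hV.exists_eq_append hl
          exact ⟨C, rfl⟩
      rw [← (Equiv.ofBijective e he).tsum_eq]
      refine tsum_congr fun C => ?_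
      rw [← pow_add]
      congr 1
      simp only [Equiv.ofBijective_apply, e, List.length_append]
      omega
    · let e : {B : List α | B ≠ [] ∧ Border B U} →
          {V | Border U V ∧ V.length < 2 * U.length} := fun B =>
        ⟨U ++ U.drop B.1.length, B.2.2.append_drop, by
          have := List.length_pos_iff.2 B.2.1
          have := B.2.2.length_le
          simp only [List.length_append, List.length_drop]; omega⟩
      have he : e.Bijective := by
        constructor
        · rintro ⟨B, hB⟩ ⟨C, hC⟩ h
          have := congrArg (fun V => V.1.length) h
          simp only [e, List.length_append, List.length_drop] at this
          have h1 := hB.2.length_le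
          have h2 := hC.2.length_le
          have hl : B.length = C.length := by omega
          exact Subtype.ext ((hB.2.of_length_le hC.2 hl.le).eq_of_length_le hl.ge)
        · rintro ⟨V, hV, hl⟩
          obtain ⟨B, hB, hBU, rfl⟩ := hV.exists_overlap hl
          exact ⟨⟨B, hB, hBU⟩, rfl⟩
      rw [wordWeight, ← (Equiv.ofBijective e he).tsum_eq]
      refine tsum_congr fun B => ?_
      congr 1
      have := B.2.2.length_le
      simp only [Equiv.ofBijective_apply, e, List.length_append, List.length_drop]
      omega
  · rw [Set.disjoint_left]
    rintro V ⟨-, h⟩ ⟨-, h'⟩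
    omega

theorem wordWeight_eq_tsum_borderMin {P : List α → Prop}
    (hP : ∀ U V, P U → Border U V → P V) :
    wordWeight x {V | P V} = ∑' U : borderMin P, wordWeight x {V | Border U.1 V} := by
  unfold wordWeight
  rw [← ENNReal.tsum_sigma' (fun p : (Σ U : borderMin P, {V | Border U.1 V}) => x ^ p.2.1.length)]
  let e : (Σ U : borderMin P, {V | Border U.1 V}) → {V | P V} :=
    fun p => ⟨p.2.1, hP _ _ p.1.2.1 p.2.2⟩
  have he : e.Bijective := by
    constructor
    · rintro ⟨⟨U, hU⟩, V, hV⟩ ⟨⟨U', hU'⟩, V', hV'⟩ h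
      obtain rfl : V = V' := congrArg Subtype.val h
      obtain rfl := borderMin_unique hU hU' hV hV'
      rfl
    · rintro ⟨V, hV⟩
      obtain ⟨U, hU, hUV⟩ := exists_borderMin hV
      exact ⟨⟨⟨U, hU⟩, V, hUV⟩, rfl⟩
  rw [← (Equiv.ofBijective e he).tsum_eq]
  rfl

variable {L : List α}

theorem tsum_setOf_border_append_self (hL : L ∈ borderMin (fun V : List α => V ≠ []))
    (f : List α → ℝ≥0∞) :
    ∑' B : {B : List α | B ≠ [] ∧ Border B (L ++ L)}, f B.1 = f L + f (L ++ L) := by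
  have hne : L ≠ L ++ L := fun h => hL.1 (by simpa using h)
  rw [setOf_border_append_self hL, Set.insert_eq,
    ENNReal.summable.tsum_union_disjoint (f := f) (by simpa using hne) ENNReal.summable,
    tsum_singleton L f, tsum_singleton (L ++ L) f]

theorem tsum_setOf_border_self (hL : L ∈ borderMin (fun V : List α => V ≠ []))
    (f : List α → ℝ≥0∞) :
    ∑' B : {B : List α | B ≠ [] ∧ Border B L}, f B.1 = f L := by
  have : {B : List α | B ≠ [] ∧ Border B L} = {L} := by
    ext B
    constructor
    · rintro ⟨hB, h⟩
      exact hL.2 B hB h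
    · rintro rfl
      exact ⟨hL.1, Border.refl _⟩
  rw [this, tsum_singleton L f]

open Classical in
theorem tsum_setOf_border_of_mem_borderMin (hL : L ∈ borderMin (fun V : List α => V ≠ []))
    {U : List α} (hU : U ∈ borderMin (LongBorder L (2 * L.length))) (f : List α → ℝ≥0∞) :
    ∑' B : {B : List α | B ≠ [] ∧ Border B U}, f B.1 =
      f U + f L + if Border (L ++ L) U then f (L ++ L) else 0 := by
  have hl := hU.1.2
  have hl0 := List.length_pos_iff.2 hL.1
  have hUL : U ≠ L := by rintro rfl; omega
  have hULL : U ≠ L ++ L := by rintro rfl; simp only [List.length_append] at hl; omega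
  have hS := setOf_border_of_mem_borderMin hL hU
  split_ifs at hS ⊢ with h
  · rw [hS, ENNReal.summable.tsum_union_disjoint (f := f) (by simp [hULL.symm, hL.1])
      ENNReal.summable,
      Set.insert_eq,
      ENNReal.summable.tsum_union_disjoint (f := f) (by simpa using hUL) ENNReal.summable,
      tsum_singleton L f, tsum_singleton U f, tsum_singleton (L ++ L) f]
  · rw [hS, Set.union_empty, Set.insert_eq,
      ENNReal.summable.tsum_union_disjoint (f := f) (by simpa using hUL) ENNReal.summable,
      tsum_singleton L f, tsum_singleton U f, add_zero]

theorem pow_two_mul_sub (hx0 : x ≠ 0) (hx : x ≠ ∞) {m k : ℕ} (h : k ≤ 2 * m) :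
    x ^ (2 * m - k) = (x ^ 2) ^ m * (x ^ k)⁻¹ := by
  rw [← ENNReal.div_eq_inv_mul.trans (mul_comm _ _),
    ENNReal.eq_div_iff (pow_ne_zero _ hx0) (ENNReal.pow_ne_top hx),
    ← pow_add, ← pow_mul]
  congr 1
  omega

open Classical in
theorem wordWeight_setOf_border_of_mem_borderMin (hx0 : x ≠ 0) (hx : x ≠ ∞)
    (hL : L ∈ borderMin (fun V : List α => V ≠ [])) {U : List α}
    (hU : U ∈ borderMin (LongBorder L (2 * L.length))) :
    wordWeight x {V | Border U V} =
      x ^ U.length + (x ^ 2) ^ U.length *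
        (wordWeight x (Set.univ : Set (List α)) + (x ^ L.length)⁻¹) +
        if Border (L ++ L) U then (x ^ 2) ^ U.length * (x ^ (2 * L.length))⁻¹ else 0 := by
  have hl := hU.1.2
  rw [wordWeight_setOf_border,
    tsum_setOf_border_of_mem_borderMin hL hU (fun B => x ^ (2 * U.length - B.length))]
  have h1 : 2 * U.length - U.length = U.length := by omega
  simp only [List.length_append, ← two_mul]
  rw [h1, pow_two_mul_sub hx0 hx (by omega), pow_two_mul_sub hx0 hx (by omega), pow_mul]
  ring

theorem wordWeight_borderMin_append_self (hx0 : x ≠ 0) (hx : x ≠ ∞)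
    (hL : L ∈ borderMin (fun V : List α => V ≠ [])) :
    wordWeight x (borderMin (LongBorder (L ++ L) (2 * L.length))) +
      wordWeight (x ^ 2) (borderMin (LongBorder (L ++ L) (2 * L.length))) *
        (wordWeight x (Set.univ : Set (List α)) + (x ^ L.length)⁻¹ + (x ^ (2 * L.length))⁻¹) +
      x ^ (2 * L.length) =
    x ^ (4 * L.length) * wordWeight x (Set.univ : Set (List α)) + x ^ (3 * L.length) +
      x ^ (2 * L.length) := by
  have hsplit : {V | Border (L ++ L) V} =
      {V | LongBorder (L ++ L) (2 * L.length) V} ∪ {L ++ L} := by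
    ext V
    constructor
    · intro h
      rcases lt_or_ge (2 * L.length) V.length with hl | hl
      · exact Or.inl ⟨h, hl⟩
      · exact Or.inr (h.eq_of_length_le (by simp only [List.length_append]; omega)).symm
    · rintro (h | rfl)
      · exact h.1
      · exact Border.refl _
  have hdisj : Disjoint {V | LongBorder (L ++ L) (2 * L.length) V} {L ++ L} := by
    rw [Set.disjoint_singleton_right]
    rintro ⟨-, h⟩
    simp only [List.length_append] at h
    omega
  have h := wordWeight_setOf_border (x := x) (L ++ L)
  rw [tsum_setOf_border_append_self hL (fun B => x ^ (2 * (L ++ L).length - B.length)),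
    hsplit, wordWeight_union hdisj, wordWeight_singleton,
    wordWeight_eq_tsum_borderMin (fun U V => LongBorder.mono),
    tsum_congr fun U : borderMin (LongBorder (L ++ L) (2 * L.length)) =>
      (wordWeight_setOf_border_of_mem_borderMin hx0 hx hL
        (mem_borderMin_append_self.1 U.2).1).trans
        (by rw [if_pos U.2.1.1, add_assoc, ← mul_add]), ENNReal.tsum_add, ENNReal.tsum_mul_right] at h
  have h1 : 2 * (2 * L.length) - L.length = 3 * L.length := by omega
  have h2 : 2 * (2 * L.length) - 2 * L.length = 2 * L.length := by omega
  have h3 : 2 * (2 * L.length) = 4 * L.length := by omega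
  simp only [List.length_append, ← two_mul] at h
  rw [h1, h2, h3, ← add_assoc] at h
  exact h

open Classical in
theorem wordWeight_borderMin (hx0 : x ≠ 0) (hx : x ≠ ∞)
    (hL : L ∈ borderMin (fun V : List α => V ≠ [])) :
    wordWeight x (borderMin (LongBorder L (2 * L.length))) +
      wordWeight (x ^ 2) (borderMin (LongBorder L (2 * L.length))) *
        (wordWeight x (Set.univ : Set (List α)) + (x ^ L.length)⁻¹) +
      wordWeight (x ^ 2) (borderMin (LongBorder (L ++ L) (2 * L.length))) *
        (x ^ (2 * L.length))⁻¹ +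
      x ^ (2 * L.length) + x ^ L.length =
    x ^ (2 * L.length) * wordWeight x (Set.univ : Set (List α)) + x ^ L.length := by
  have hl0 := List.length_pos_iff.2 hL.1
  have hsplit : {V | Border L V} = ({V | LongBorder L (2 * L.length) V} ∪ {L ++ L}) ∪ {L} := by
    ext V
    constructor
    · intro h
      rcases lt_or_ge (2 * L.length) V.length with hl | hl
      · exact Or.inl (Or.inl ⟨h, hl⟩)
      · rcases eq_or_eq_append_self hL h hl with rfl | rfl
        · exact Or.inr rfl
        · exact Or.inl (Or.inr rfl)
    · rintro ((h | rfl) | rfl)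
      · exact h.1
      · exact Border.append_self _
      · exact Border.refl _
  have hdisj : Disjoint {V | LongBorder L (2 * L.length) V} {L ++ L} := by
    rw [Set.disjoint_singleton_right]
    rintro ⟨-, h⟩
    simp only [List.length_append] at h
    omega
  have hdisj' : Disjoint ({V | LongBorder L (2 * L.length) V} ∪ {L ++ L}) {L} := by
    rw [Set.disjoint_singleton_right]
    rintro (⟨-, h⟩ | h)
    · omega
    · exact hL.1 (by simpa using h)
  have hsum : ∑' U : borderMin (LongBorder L (2 * L.length)),
      (if Border (L ++ L) U.1 then (x ^ 2) ^ U.1.length * (x ^ (2 * L.length))⁻¹ else 0) =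
      wordWeight (x ^ 2) (borderMin (LongBorder (L ++ L) (2 * L.length))) *
        (x ^ (2 * L.length))⁻¹ := by
    rw [wordWeight, ← ENNReal.tsum_mul_right,
      tsum_subtype (borderMin (LongBorder (L ++ L) (2 * L.length)))
        (fun U => (x ^ 2) ^ U.length * (x ^ (2 * L.length))⁻¹),
      tsum_subtype (borderMin (LongBorder L (2 * L.length)))
        (fun U => if Border (L ++ L) U then (x ^ 2) ^ U.length * (x ^ (2 * L.length))⁻¹ else 0)]
    refine tsum_congr fun U => ?_
    by_cases h1 : U ∈ borderMin (LongBorder L (2 * L.length)) <;>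
      by_cases h2 : Border (L ++ L) U <;>
      simp [Set.indicator, mem_borderMin_append_self, h1, h2]
  have h := wordWeight_setOf_border (x := x) L
  rw [tsum_setOf_border_self hL (fun B => x ^ (2 * L.length - B.length)),
    hsplit, wordWeight_union hdisj', wordWeight_union hdisj, wordWeight_singleton,
    wordWeight_singleton, wordWeight_eq_tsum_borderMin (fun U V => LongBorder.mono),
    tsum_congr fun U : borderMin (LongBorder L (2 * L.length)) =>
      wordWeight_setOf_border_of_mem_borderMin hx0 hx hL U.2,
    ENNReal.tsum_add, ENNReal.tsum_add, ENNReal.tsum_mul_right, hsum] at h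
  have h1 : 2 * L.length - L.length = L.length := by omega
  simp only [List.length_append, ← two_mul] at h
  rw [h1] at h
  exact h

end Weight

section Count

variable {q : ℕ}

theorem encard_length_eq (n : ℕ) :
    ENat.card {V : List (Fin q) // V.length = n} = (q : ℕ∞) ^ n := by
  have : ENat.card (List.Vector (Fin q) n) = (q : ℕ∞) ^ n := by
    rw [ENat.card_eq_coe_fintype_card, card_vector]; simp
  exact this

theorem wordWeight_univ (x : ℝ≥0∞) :
    wordWeight x (Set.univ : Set (List (Fin q))) = (1 - q * x)⁻¹ := by
  rw [wordWeight, tsum_univ (fun V : List (Fin q) => x ^ V.length),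
    ← (Equiv.sigmaFiberEquiv (List.length (α := Fin q))).tsum_eq, ENNReal.tsum_sigma',
    ← ENNReal.tsum_geometric]
  refine tsum_congr fun n => ?_
  have : ∀ V : {V : List (Fin q) // V.length = n},
      x ^ ((Equiv.sigmaFiberEquiv (List.length (α := Fin q))) ⟨n, V⟩).length = x ^ n := by
    rintro ⟨V, rfl⟩; rfl
  rw [tsum_congr this, ENNReal.tsum_const, encard_length_eq, mul_pow]
  simp

end Count

section Recurrence

variable {q : ℕ}

theorem one_sub_pos_of_mul_lt {x : ℝ} (hqx : q * x < 1) :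
    0 < 1 - (q : ℝ≥0∞) * ENNReal.ofReal x := by
  rw [tsub_pos_iff_lt, ← ENNReal.ofReal_natCast, ← ENNReal.ofReal_mul (by positivity)]
  exact ENNReal.ofReal_lt_one.2 hqx

theorem wordWeight_ne_top {x : ℝ} (hqx : q * x < 1) (S : Set (List (Fin q))) :
    wordWeight (ENNReal.ofReal x) S ≠ ∞ := by
  refine ne_top_of_le_ne_top ?_ (wordWeight_mono (Set.subset_univ S))
  rw [wordWeight_univ, ENNReal.inv_ne_top]
  exact (one_sub_pos_of_mul_lt hqx).ne'

theorem toReal_wordWeight_univ {x : ℝ} (hx : 0 ≤ x) (hqx : q * x < 1) :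
    (wordWeight (ENNReal.ofReal x) (Set.univ : Set (List (Fin q)))).toReal = (1 - q * x)⁻¹ := by
  rw [wordWeight_univ, ENNReal.toReal_inv,
    ENNReal.toReal_sub_of_le (tsub_pos_iff_lt.1 (one_sub_pos_of_mul_lt hqx)).le ENNReal.one_ne_top]
  simp [hx]

/-- The generating function of the minimal words `LXL`, `X` nonempty. -/
noncomputable def minWeight (L : List (Fin q)) (x : ℝ) : ℝ :=
  (wordWeight (ENNReal.ofReal x) (borderMin (LongBorder L (2 * L.length)))).toReal

/-- The generating function of the minimal words `LXL`, `X` nonempty, with border `LL`. -/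
noncomputable def minWeightTwo (L : List (Fin q)) (x : ℝ) : ℝ :=
  (wordWeight (ENNReal.ofReal x) (borderMin (LongBorder (L ++ L) (2 * L.length)))).toReal

variable {L : List (Fin q)} {x : ℝ}

theorem minWeight_nonneg : 0 ≤ minWeight L x := ENNReal.toReal_nonneg

theorem minWeightTwo_nonneg : 0 ≤ minWeightTwo L x := ENNReal.toReal_nonneg

theorem minWeightTwo_le_minWeight (hqx : q * x < 1) : minWeightTwo L x ≤ minWeight L x :=
  ENNReal.toReal_mono (wordWeight_ne_top hqx _)
    (wordWeight_mono fun _ hU => (mem_borderMin_append_self.1 hU).1)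

theorem pow_le_minWeightTwo (hL : L ∈ borderMin (fun V : List (Fin q) => V ≠ []))
    (hx : 0 ≤ x) (hqx : q * x < 1) : x ^ (3 * L.length) ≤ minWeightTwo L x := by
  have h := ENNReal.toReal_mono (wordWeight_ne_top hqx _) (wordWeight_mono
    (x := ENNReal.ofReal x) (Set.singleton_subset_iff.2 (append_append_mem_borderMin hL)))
  rw [wordWeight_singleton, ENNReal.toReal_pow, ENNReal.toReal_ofReal hx] at h
  have hl : (L ++ L ++ L).length = 3 * L.length := by simp only [List.length_append]; omega
  rwa [hl] at h

theorem mul_sq_lt_one (hx : 0 < x) (hx1 : x < 1) (hqx : q * x < 1) : q * x ^ 2 < 1 := by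
  have : (q : ℝ) * x ^ 2 = (q * x) * x := by ring
  rw [this]
  exact mul_lt_one_of_nonneg_of_lt_one_left (by positivity) hqx hx1.le

theorem minWeightTwo_eq (hL : L ∈ borderMin (fun V : List (Fin q) => V ≠ []))
    (hx : 0 < x) (hx1 : x < 1) (hqx : q * x < 1) :
    minWeightTwo L x + minWeightTwo L (x ^ 2) *
      ((1 - q * x)⁻¹ + (x ^ L.length)⁻¹ + (x ^ (2 * L.length))⁻¹) =
    x ^ (4 * L.length) * (1 - q * x)⁻¹ + x ^ (3 * L.length) := by
  have hX0 : ENNReal.ofReal x ≠ 0 := by simpa using hx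
  have h := congrArg ENNReal.toReal (wordWeight_borderMin_append_self hX0 ENNReal.ofReal_ne_top hL)
  have hF := wordWeight_ne_top hqx (borderMin (LongBorder (L ++ L) (2 * L.length)))
  have hF2 := wordWeight_ne_top (mul_sq_lt_one hx hx1 hqx)
    (borderMin (LongBorder (L ++ L) (2 * L.length)))
  have hA := wordWeight_ne_top hqx Set.univ
  have hi : ∀ n, (ENNReal.ofReal x ^ n)⁻¹ ≠ ∞ := fun n => ENNReal.inv_ne_top.2 (pow_ne_zero _ hX0)
  have hp : ∀ n, ENNReal.ofReal x ^ n ≠ ∞ := fun n => ENNReal.pow_ne_top ENNReal.ofReal_ne_top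
  rw [← ENNReal.ofReal_pow hx.le 2] at h
  rw [ENNReal.toReal_add (by finiteness) (by finiteness),
    ENNReal.toReal_add (by finiteness) (by finiteness), ENNReal.toReal_mul,
    ENNReal.toReal_add (by finiteness) (by finiteness),
    ENNReal.toReal_add (by finiteness) (by finiteness),
    ENNReal.toReal_add (by finiteness) (by finiteness),
    ENNReal.toReal_add (by finiteness) (by finiteness), ENNReal.toReal_mul,
    toReal_wordWeight_univ hx.le hqx] at h
  simp only [ENNReal.toReal_inv, ENNReal.toReal_pow, ENNReal.toReal_ofReal hx.le] at h
  exact add_right_cancel h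

theorem minWeight_eq (hL : L ∈ borderMin (fun V : List (Fin q) => V ≠ []))
    (hx : 0 < x) (hx1 : x < 1) (hqx : q * x < 1) :
    minWeight L x + minWeight L (x ^ 2) * ((1 - q * x)⁻¹ + (x ^ L.length)⁻¹) +
      minWeightTwo L (x ^ 2) * (x ^ (2 * L.length))⁻¹ + x ^ (2 * L.length) =
    x ^ (2 * L.length) * (1 - q * x)⁻¹ := by
  have hX0 : ENNReal.ofReal x ≠ 0 := by simpa using hx
  have h := congrArg ENNReal.toReal (wordWeight_borderMin hX0 ENNReal.ofReal_ne_top hL)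
  have hF := wordWeight_ne_top hqx (borderMin (LongBorder L (2 * L.length)))
  have hF2 := wordWeight_ne_top (mul_sq_lt_one hx hx1 hqx)
    (borderMin (LongBorder L (2 * L.length)))
  have hE2 := wordWeight_ne_top (mul_sq_lt_one hx hx1 hqx)
    (borderMin (LongBorder (L ++ L) (2 * L.length)))
  have hA := wordWeight_ne_top hqx Set.univ
  have hi : ∀ n, (ENNReal.ofReal x ^ n)⁻¹ ≠ ∞ := fun n => ENNReal.inv_ne_top.2 (pow_ne_zero _ hX0)
  have hp : ∀ n, ENNReal.ofReal x ^ n ≠ ∞ := fun n => ENNReal.pow_ne_top ENNReal.ofReal_ne_top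
  rw [← ENNReal.ofReal_pow hx.le 2] at h
  rw [ENNReal.toReal_add (by finiteness) (by finiteness),
    ENNReal.toReal_add (by finiteness) (by finiteness),
    ENNReal.toReal_add (by finiteness) (by finiteness),
    ENNReal.toReal_add (by finiteness) (by finiteness), ENNReal.toReal_mul,
    ENNReal.toReal_add (by finiteness) (by finiteness), ENNReal.toReal_mul,
    ENNReal.toReal_add (by finiteness) (by finiteness), ENNReal.toReal_mul,
    toReal_wordWeight_univ hx.le hqx] at h
  simp only [ENNReal.toReal_inv, ENNReal.toReal_pow, ENNReal.toReal_ofReal hx.le] at h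
  exact add_right_cancel h

theorem uPoly_recurrence (hL : L ∈ borderMin (fun V : List (Fin q) => V ≠ []))
    (hx : 0 < x) (hx1 : x < 1) (hqx : q * x < 1) :
    (1 - q * x) * (minWeightTwo L x - x ^ (3 * L.length)) =
      uPoly q L.length x - vPoly q L.length x *
        (minWeightTwo L (x ^ 2) - (x ^ 2) ^ (3 * L.length)) := by
  have h := minWeightTwo_eq hL hx hx1 hqx
  have hd : 1 - q * x ≠ 0 := by linarith
  have hx0 := hx.ne'
  generalize minWeightTwo L x = E at *
  generalize minWeightTwo L (x ^ 2) = E₂ at *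
  have hy : x ^ L.length ≠ 0 := pow_ne_zero _ hx0
  have h6 : (x ^ 2) ^ (3 * L.length) = (x ^ L.length) ^ 6 := by
    rw [← pow_mul, ← pow_mul]; congr 1; omega
  rw [h6]
  simp only [uPoly, vPoly, zpow_add₀ hx0, zpow_sub₀ hx0, zpow_neg, mul_comm _ (L.length : ℤ),
    zpow_mul, zpow_natCast, zpow_ofNat]
  simp only [mul_comm _ L.length, pow_mul, pow_one] at h ⊢
  generalize x ^ L.length = y at *
  field_simp at h ⊢
  linear_combination h

theorem rPoly_recurrence (hL : L ∈ borderMin (fun V : List (Fin q) => V ≠ []))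
    (hx : 0 < x) (hx1 : x < 1) (hqx : q * x < 1) :
    (1 - q * x) * (minWeight L x - minWeightTwo L x + x ^ (3 * L.length)) =
      rPoly q L.length x - sPoly q L.length x *
        (minWeight L (x ^ 2) - minWeightTwo L (x ^ 2) + (x ^ 2) ^ (3 * L.length)) := by
  have h := minWeightTwo_eq hL hx hx1 hqx
  have h' := minWeight_eq hL hx hx1 hqx
  have hd : 1 - q * x ≠ 0 := by linarith
  have hx0 := hx.ne'
  generalize minWeightTwo L x = E at *
  generalize minWeightTwo L (x ^ 2) = E₂ at *
  generalize minWeight L x = F at *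
  generalize minWeight L (x ^ 2) = F₂ at *
  have hy : x ^ L.length ≠ 0 := pow_ne_zero _ hx0
  have h6 : (x ^ 2) ^ (3 * L.length) = (x ^ L.length) ^ 6 := by
    rw [← pow_mul, ← pow_mul]; congr 1; omega
  rw [h6]
  simp only [rPoly, sPoly, zpow_add₀ hx0, zpow_sub₀ hx0, zpow_neg, mul_comm _ (L.length : ℤ),
    zpow_mul, zpow_natCast, zpow_ofNat]
  simp only [mul_comm _ L.length, pow_mul, pow_one] at h h' ⊢
  generalize x ^ L.length = y at *
  field_simp at h h' ⊢
  refine mul_left_cancel₀ hy ?_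
  linear_combination h' - h

theorem sPoly_nonneg {ℓ : ℕ} (hx : 0 < x) (hqx : q * x < 1) : 0 ≤ sPoly q ℓ x := by
  have : sPoly q ℓ x = 1 + (1 - q * x) * (x ^ ℓ)⁻¹ := by
    simp only [sPoly, zpow_sub₀ hx.ne', zpow_neg, zpow_one, zpow_natCast]
    ring
  rw [this]
  have := sub_pos.2 hqx
  positivity

theorem vPoly_nonneg {ℓ : ℕ} (hx : 0 < x) (hqx : q * x < 1) : 0 ≤ vPoly q ℓ x := by
  have : vPoly q ℓ x = 1 + (1 - q * x) * ((x ^ ℓ)⁻¹ + ((x ^ ℓ) ^ 2)⁻¹) := by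
    simp only [vPoly, zpow_sub₀ hx.ne', zpow_neg, zpow_natCast,
      mul_comm _ (ℓ : ℤ), zpow_mul, zpow_ofNat]
    ring
  rw [this]
  have := sub_pos.2 hqx
  positivity

theorem eq_sum_of_recurrence {e u v d : ℕ → ℝ} (hd : ∀ k, d k ≠ 0)
    (h : ∀ k, d k * e k = u k - v k * e (k + 1)) (n : ℕ) :
    e 0 = ∑ i ∈ Finset.range n, (-1 : ℝ) ^ i * u i * (∏ j ∈ Finset.range i, v j) /
        (∏ k ∈ Finset.range (i + 1), d k) +
      (-1) ^ n * ((∏ j ∈ Finset.range n, v j) / (∏ k ∈ Finset.range n, d k) * e n) := by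
  induction n with
  | zero => simp
  | succ n ih =>
    rw [ih, Finset.sum_range_succ, add_assoc, Finset.prod_range_succ v n,
      Finset.prod_range_succ d n]
    congr 1
    have h1 : ∏ k ∈ Finset.range n, d k ≠ 0 := Finset.prod_ne_zero_iff.2 fun k _ => hd k
    have h2 := hd n
    have h3 : e n = (u n - v n * e (n + 1)) / d n := by rw [← h n]; field_simp
    rw [h3]
    field_simp
    ring

theorem alternating_bounds {e u v d : ℕ → ℝ} (hd : ∀ k, 0 < d k) (hv : ∀ k, 0 ≤ v k)
    (he : ∀ k, 0 ≤ e k) (h : ∀ k, d k * e k = u k - v k * e (k + 1)) (M : ℕ) :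
    ∑ i ∈ Finset.range (2 * M + 2), (-1 : ℝ) ^ i * u i * (∏ j ∈ Finset.range i, v j) /
        (∏ k ∈ Finset.range (i + 1), d k) ≤ e 0 ∧
    e 0 ≤ ∑ i ∈ Finset.range (2 * M + 1), (-1 : ℝ) ^ i * u i * (∏ j ∈ Finset.range i, v j) /
        (∏ k ∈ Finset.range (i + 1), d k) := by
  have hnn : ∀ n, 0 ≤ (∏ j ∈ Finset.range n, v j) / (∏ k ∈ Finset.range n, d k) * e n :=
    fun n => mul_nonneg (div_nonneg (Finset.prod_nonneg fun k _ => hv k)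
      (Finset.prod_nonneg fun k _ => (hd k).le)) (he n)
  constructor
  · rw [eq_sum_of_recurrence (fun k => (hd k).ne') h (2 * M + 2),
      (show Even (2 * M + 2) by simp [parity_simps]).neg_one_pow]
    linarith [hnn (2 * M + 2)]
  · rw [eq_sum_of_recurrence (fun k => (hd k).ne') h (2 * M + 1),
      (show Odd (2 * M + 1) from ⟨M, rfl⟩).neg_one_pow]
    linarith [hnn (2 * M + 1)]

theorem minWeight_bounds (hq : 2 ≤ q) (hL : L ∈ borderMin (fun V : List (Fin q) => V ≠ []))
    (M : ℕ) :
    ∑ i ∈ Finset.range (2 * M + 2), (Gterm q L.length i + Hterm q L.length i) ≤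
        minWeight L (((q : ℝ) ^ 2)⁻¹) ∧
      minWeight L (((q : ℝ) ^ 2)⁻¹) ≤
        ∑ i ∈ Finset.range (2 * M + 1), (Gterm q L.length i + Hterm q L.length i) := by
  have hq1 : (1 : ℝ) < q := by exact_mod_cast hq
  have hq0 : (0 : ℝ) < q := by linarith
  set z : ℕ → ℝ := fun k => (q : ℝ) ^ (-(2 : ℤ) ^ (k + 1)) with hz
  have hzs : ∀ k, z (k + 1) = z k ^ 2 := fun k => by
    simp only [hz]
    rw [← zpow_natCast, ← zpow_mul]
    congr 1
    push_cast
    ring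
  have hz0 : ∀ k, 0 < z k := fun k => zpow_pos hq0 _
  have hd : ∀ k, 1 - (q : ℝ) ^ ((1 : ℤ) - 2 ^ (k + 1)) = 1 - q * z k := fun k => by
    rw [sub_eq_add_neg (1 : ℤ), zpow_add₀ hq0.ne', zpow_one]
  have hqz : ∀ k, q * z k < 1 := fun k => by
    have h2 : (1 : ℤ) < 2 ^ (k + 1) := one_lt_pow₀ (by norm_num) (by omega)
    have h3 : (q : ℝ) * z k = (q : ℝ) ^ ((1 : ℤ) - 2 ^ (k + 1)) := by linarith [hd k]
    rw [h3]
    exact zpow_lt_one_of_neg₀ hq1 (by omega)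
  have hz1 : ∀ k, z k < 1 := fun k => by nlinarith [hz0 k, hqz k]
  have hzero : ((q : ℝ) ^ 2)⁻¹ = z 0 := by
    simp only [hz, zero_add, pow_one, zpow_neg, zpow_ofNat]
  have hE := alternating_bounds (e := fun k => minWeightTwo L (z k) - z k ^ (3 * L.length))
    (u := fun k => uPoly q L.length (z k)) (v := fun k => vPoly q L.length (z k))
    (d := fun k => 1 - q * z k) (fun k => sub_pos.2 (hqz k))
    (fun k => vPoly_nonneg (hz0 k) (hqz k))
    (fun k => sub_nonneg.2 (pow_le_minWeightTwo hL (hz0 k).le (hqz k)))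
    (fun k => by
      simp only [hzs]
      exact uPoly_recurrence hL (hz0 k) (hz1 k) (hqz k)) M
  have hG := alternating_bounds
    (e := fun k => minWeight L (z k) - minWeightTwo L (z k) + z k ^ (3 * L.length))
    (u := fun k => rPoly q L.length (z k)) (v := fun k => sPoly q L.length (z k))
    (d := fun k => 1 - q * z k) (fun k => sub_pos.2 (hqz k))
    (fun k => sPoly_nonneg (hz0 k) (hqz k))
    (fun k => add_nonneg (sub_nonneg.2 (minWeightTwo_le_minWeight (hqz k)))
      (pow_nonneg (hz0 k).le _))
    (fun k => by
      simp only [hzs]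
      exact rPoly_recurrence hL (hz0 k) (hz1 k) (hqz k)) M
  simp only [Gterm, Hterm, Finset.sum_add_distrib, hd, hzero]
  constructor <;> linarith [hE.1, hE.2, hG.1, hG.2]

theorem minWeight_le (hq : 2 ≤ q) (hL : L ∈ borderMin (fun V : List (Fin q) => V ≠ [])) :
    minWeight L (((q : ℝ) ^ 2)⁻¹) ≤ (((q : ℝ) ^ 2)⁻¹) ^ L.length := by
  have hq1 : (2 : ℝ) ≤ q := by exact_mod_cast hq
  have hx : 0 < ((q : ℝ) ^ 2)⁻¹ := by positivity
  have hx1 : ((q : ℝ) ^ 2)⁻¹ < 1 := inv_lt_one_of_one_lt₀ (by nlinarith)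
  have hqx' : q * ((q : ℝ) ^ 2)⁻¹ = (q : ℝ)⁻¹ := by field_simp
  have hqx2 : (q : ℝ)⁻¹ ≤ 2⁻¹ := inv_anti₀ (by norm_num) hq1
  have hqx : q * ((q : ℝ) ^ 2)⁻¹ < 1 := by rw [hqx']; linarith
  have h := minWeight_eq hL hx hx1 hqx
  rw [hqx'] at h
  generalize ((q : ℝ) ^ 2)⁻¹ = x at *
  have hA : (1 - (q : ℝ)⁻¹)⁻¹ ≤ 2 := by
    rw [inv_le_comm₀ (by linarith) (by norm_num)]; linarith
  have hA0 : 0 ≤ (1 - (q : ℝ)⁻¹)⁻¹ := inv_nonneg.2 (by linarith)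
  have hp := pow_pos hx L.length
  have hp2 := pow_pos hx (2 * L.length)
  have hp1 : x ^ (2 * L.length) ≤ x ^ L.length := pow_le_pow_of_le_one hx.le hx1.le (by omega)
  have h1 : 0 ≤ minWeight L (x ^ 2) * ((1 - (q : ℝ)⁻¹)⁻¹ + (x ^ L.length)⁻¹) :=
    mul_nonneg minWeight_nonneg (by positivity)
  have h2 : 0 ≤ minWeightTwo L (x ^ 2) * (x ^ (2 * L.length))⁻¹ :=
    mul_nonneg minWeightTwo_nonneg (by positivity)
  nlinarith

end Recurrence

section Density

/-- Pairs `⟨L, V⟩` with `L` nonempty bifix-free and `V` minimal among the words `LXL`. -/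
abbrev MinPair (q : ℕ) : Type :=
  Σ L : borderMin (fun V : List (Fin q) => V ≠ []), borderMin (LongBorder L.1 (2 * L.1.length))

variable {q : ℕ}

theorem MinPair.ext_of_border {p p' : MinPair q} {W : List (Fin q)} (h : Border p.2.1 W)
    (h' : Border p'.2.1 W) : p = p' := by
  obtain ⟨⟨L, hL⟩, V, hV⟩ := p
  obtain ⟨⟨L', hL'⟩, V', hV'⟩ := p'
  obtain rfl := borderMin_unique hL hL' (hV.1.1.trans h) (hV'.1.1.trans h')
  obtain rfl := borderMin_unique hV hV' h h'
  rfl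

theorem MinPair.val_injective : Function.Injective (fun p : MinPair q => p.2.1) :=
  fun p p' (h : p.2.1 = p'.2.1) =>
    MinPair.ext_of_border (Border.refl p.2.1) (h ▸ Border.refl p'.2.1)

theorem finite_length_eq (n : ℕ) : Finite {V : List (Fin q) // V.length = n} :=
  inferInstanceAs (Finite (List.Vector (Fin q) n))

theorem card_z3Instance (n : ℕ) :
    (Nat.card {W : List (Fin q) // W.length = n ∧ Z3Instance W} : ℝ≥0∞) =
      ∑' p : MinPair q, if 2 * p.2.1.length < n then (q : ℝ≥0∞) ^ (n - 2 * p.2.1.length)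
        else 0 := by
  have : Finite {W : List (Fin q) // W.length = n ∧ Z3Instance W} :=
    have := finite_length_eq (q := q) n
    Finite.of_injective (fun W => (⟨W.1, W.2.1⟩ : {V : List (Fin q) // V.length = n}))
      fun W W' h => Subtype.ext (Subtype.mk.inj h)
  have hone := ENNReal.tsum_const (α := {W : List (Fin q) // W.length = n ∧ Z3Instance W}) 1
  rw [mul_one, ENat.card_eq_coe_natCard, ENat.toENNReal_coe] at hone
  rw [← hone]
  let e : (Σ p : {p : MinPair q | 2 * p.2.1.length < n},
      {C : List (Fin q) // C.length = n - 2 * p.1.2.1.length}) →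
      {W : List (Fin q) // W.length = n ∧ Z3Instance W} :=
    fun t => ⟨t.1.1.2.1 ++ t.2.1 ++ t.1.1.2.1, by
      have h1 : 2 * t.1.1.2.1.length < n := t.1.2
      have h2 := t.2.2
      refine ⟨by simp only [List.length_append]; omega, z3Instance_iff.2
        ⟨t.1.1.1.1, t.1.1.1.2, t.1.1.2.1, t.1.1.2.2, t.2.1, ?_, rfl⟩⟩
      intro h
      rw [h, List.length_nil] at h2
      omega⟩
  have he : e.Bijective := by
    constructor
    · rintro ⟨⟨p, hp⟩, C, hC⟩ ⟨⟨p', hp'⟩, C', hC'⟩ h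
      have h' : p.2.1 ++ C ++ p.2.1 = p'.2.1 ++ C' ++ p'.2.1 := congrArg Subtype.val h
      obtain rfl : p = p' := MinPair.ext_of_border (Border.append_append p.2.1 C)
        (h' ▸ Border.append_append p'.2.1 C')
      obtain rfl : C = C' := by simpa using h'
      rfl
    · rintro ⟨W, hW, h⟩
      obtain ⟨L, hL, V, hV, C, hC, rfl⟩ := z3Instance_iff.1 h
      have := List.length_pos_iff.2 hC
      simp only [List.length_append] at hW
      exact ⟨⟨⟨⟨⟨L, hL⟩, V, hV⟩, show 2 * V.length < n by omega⟩, C,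
        show C.length = n - 2 * V.length by omega⟩, rfl⟩
  rw [← (Equiv.ofBijective e he).tsum_eq, ENNReal.tsum_sigma']
  have h1 : ∀ p : {p : MinPair q | 2 * p.2.1.length < n},
      ∑' _ : {C : List (Fin q) // C.length = n - 2 * p.1.2.1.length}, (1 : ℝ≥0∞) =
        (q : ℝ≥0∞) ^ (n - 2 * p.1.2.1.length) := fun p => by
    rw [ENNReal.tsum_const, encard_length_eq]
    simp
  rw [tsum_congr h1, tsum_subtype {p : MinPair q | 2 * p.2.1.length < n}
    (fun p => (q : ℝ≥0∞) ^ (n - 2 * p.2.1.length))]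
  refine tsum_congr fun p => ?_
  rw [Set.indicator_apply]
  exact if_congr Iff.rfl rfl rfl

theorem instProb3_eq_tsum (hq : 2 ≤ q) (n : ℕ) :
    instProb3 q n = ∑' p : MinPair q,
      if 2 * p.2.1.length < n then (((q : ℝ) ^ 2)⁻¹) ^ p.2.1.length else 0 := by
  have hq0 : (q : ℝ) ≠ 0 := by
    have : q ≠ 0 := by omega
    exact_mod_cast this
  have h := congrArg ENNReal.toReal (card_z3Instance (q := q) n)
  rw [ENNReal.tsum_toReal_eq (fun p => by split_ifs <;> simp), ENNReal.toReal_natCast] at h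
  rw [instProb3, h, ← tsum_div_const]
  refine tsum_congr fun p => ?_
  split_ifs with hp
  · rw [ENNReal.toReal_pow, ENNReal.toReal_natCast, inv_pow, ← pow_mul, pow_sub₀ _ hq0 hp.le]
    field_simp
  · simp

/-- The contribution to the limit density of the `L` of length `ℓ`. -/
noncomputable def lengthWeight (q ℓ : ℕ) (x : ℝ) : ℝ≥0∞ :=
  ∑' L : {L : borderMin (fun V : List (Fin q) => V ≠ []) // L.1.length = ℓ},
    wordWeight (ENNReal.ofReal x) (borderMin (LongBorder L.1.1 (2 * L.1.1.length)))

theorem tsum_minPair (x : ℝ) :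
    ∑' p : MinPair q, (ENNReal.ofReal x) ^ p.2.1.length = ∑' ℓ, lengthWeight q ℓ x := by
  rw [ENNReal.tsum_sigma' (fun p : MinPair q => (ENNReal.ofReal x) ^ p.2.1.length),
    ← (Equiv.sigmaFiberEquiv
      (fun L : borderMin (fun V : List (Fin q) => V ≠ []) => L.1.length)).tsum_eq,
    ENNReal.tsum_sigma']
  rfl

theorem tsum_minPair_ne_top {x : ℝ} (hqx : q * x < 1) :
    ∑' p : MinPair q, (ENNReal.ofReal x) ^ p.2.1.length ≠ ∞ := by
  refine ne_top_of_le_ne_top (wordWeight_ne_top hqx (Set.univ : Set (List (Fin q)))) ?_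
  rw [wordWeight, tsum_univ (fun V : List (Fin q) => (ENNReal.ofReal x) ^ V.length)]
  exact ENNReal.tsum_comp_le_tsum_of_injective MinPair.val_injective
    (fun V : List (Fin q) => (ENNReal.ofReal x) ^ V.length)

theorem aCount_eq_card (ℓ : ℕ) :
    aCount q ℓ =
      Nat.card {L : borderMin (fun V : List (Fin q) => V ≠ []) // L.1.length = ℓ} := by
  rw [aCount]
  split_ifs with h
  · subst h
    have : IsEmpty {L : borderMin (fun V : List (Fin q) => V ≠ []) // L.1.length = 0} :=
      ⟨fun L => L.1.2.1 (List.length_eq_zero_iff.1 L.2)⟩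
    rw [Nat.card_of_isEmpty]
  · refine Nat.card_congr ⟨fun W => ⟨⟨W.1, mem_borderMin_ne_nil.2 ⟨?_, W.2.2⟩⟩, W.2.1⟩,
      fun L => ⟨L.1.1, L.2, (mem_borderMin_ne_nil.1 L.1.2).2⟩, fun _ => rfl, fun _ => rfl⟩
    intro h0
    exact h (by rw [← W.2.1, h0, List.length_nil])

theorem finite_borderMin_length_eq (ℓ : ℕ) :
    Finite {L : borderMin (fun V : List (Fin q) => V ≠ []) // L.1.length = ℓ} :=
  have := finite_length_eq (q := q) ℓ
  Finite.of_injective (fun L => (⟨L.1.1, L.2⟩ : {V : List (Fin q) // V.length = ℓ}))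
    fun _ _ h => Subtype.ext (Subtype.ext (Subtype.mk.inj h))

theorem aCount_le (ℓ : ℕ) : aCount q ℓ ≤ q ^ ℓ := by
  rw [aCount_eq_card]
  have := finite_length_eq (q := q) ℓ
  have hc : Nat.card {V : List (Fin q) // V.length = ℓ} = q ^ ℓ := by
    have h := encard_length_eq (q := q) ℓ
    rw [ENat.card_eq_coe_natCard] at h
    exact_mod_cast h
  rw [← hc]
  exact Nat.card_le_card_of_injective
    (fun L => (⟨L.1.1, L.2⟩ : {V : List (Fin q) // V.length = ℓ}))
    fun _ _ h => Subtype.ext (Subtype.ext (Subtype.mk.inj h))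

theorem lengthWeight_bounds {ℓ : ℕ} {x a b : ℝ} (hqx : q * x < 1)
    (h : ∀ L ∈ borderMin (fun V : List (Fin q) => V ≠ []), L.length = ℓ →
      a ≤ minWeight L x ∧ minWeight L x ≤ b) :
    aCount q ℓ * a ≤ (lengthWeight q ℓ x).toReal ∧
      (lengthWeight q ℓ x).toReal ≤ aCount q ℓ * b := by
  have := finite_borderMin_length_eq (q := q) ℓ
  have := Fintype.ofFinite {L : borderMin (fun V : List (Fin q) => V ≠ []) // L.1.length = ℓ}
  have hw : (lengthWeight q ℓ x).toReal = ∑ L : {L : borderMin (fun V : List (Fin q) => V ≠ []) //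
      L.1.length = ℓ}, minWeight L.1.1 x := by
    rw [lengthWeight, tsum_fintype, ENNReal.toReal_sum fun L _ => wordWeight_ne_top hqx _]
    rfl
  rw [hw, aCount_eq_card, Nat.card_eq_fintype_card, ← nsmul_eq_mul, ← nsmul_eq_mul]
  exact ⟨Finset.card_nsmul_le_sum _ _ _ fun L _ => (h L.1.1 L.1.2 L.2).1,
    Finset.sum_le_card_nsmul _ _ _ fun L _ => (h L.1.1 L.1.2 L.2).2⟩

end Density

/-- Bounds on `I(Z₃,q)`: for all `N, M ≥ 0`,
`∑_{ℓ=1}^{N} a_ℓ ∑_{i=0}^{2M+1} (G_ℓ(i)+H_ℓ(i)) ≤ I(Z₃,q) ≤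
 q^{−N} + ∑_{ℓ=1}^{N} a_ℓ ∑_{i=0}^{2M} (G_ℓ(i)+H_ℓ(i))`. -/
theorem instProb3_limit_bounds (q N M : ℕ) (hq : 2 ≤ q) :
    ∃ I : ℝ, Filter.Tendsto (fun n => instProb3 q n) Filter.atTop (nhds I) ∧
      (∑ ℓ ∈ Finset.Icc 1 N, (aCount q ℓ : ℝ) *
        ∑ i ∈ Finset.range (2 * M + 2), (Gterm q ℓ i + Hterm q ℓ i)) ≤ I ∧
      I ≤ (q : ℝ) ^ (-(N : ℤ)) + ∑ ℓ ∈ Finset.Icc 1 N, (aCount q ℓ : ℝ) *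
        ∑ i ∈ Finset.range (2 * M + 1), (Gterm q ℓ i + Hterm q ℓ i) := by
  have hq1 : (2 : ℝ) ≤ q := by exact_mod_cast hq
  have hq0 : (0 : ℝ) < q := by linarith
  set c : ℝ := ((q : ℝ) ^ 2)⁻¹ with hc
  have hc0 : 0 < c := by positivity
  have hqc : q * c = (q : ℝ)⁻¹ := by rw [hc]; field_simp
  have hqinv : (q : ℝ)⁻¹ ≤ 2⁻¹ := inv_anti₀ (by norm_num) hq1
  have hqc1 : q * c < 1 := by rw [hqc]; linarith
  have htop := tsum_minPair_ne_top hqc1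
  have hreal : ∀ n, (ENNReal.ofReal c ^ n).toReal = c ^ n := fun n => by
    rw [ENNReal.toReal_pow, ENNReal.toReal_ofReal hc0.le]
  have hsum : Summable fun p : MinPair q => c ^ p.2.1.length := by
    simpa only [hreal] using ENNReal.summable_toReal htop
  have htsum : ∑' p : MinPair q, c ^ p.2.1.length = ∑' ℓ, (lengthWeight q ℓ c).toReal := by
    rw [tsum_minPair] at htop
    rw [← ENNReal.tsum_toReal_eq (fun ℓ => ENNReal.ne_top_of_tsum_ne_top htop ℓ),
      ← tsum_minPair, ENNReal.tsum_toReal_eq fun p => ENNReal.pow_ne_top ENNReal.ofReal_ne_top]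
    simp only [hreal]
  have hsumℓ : Summable fun ℓ => (lengthWeight q ℓ c).toReal :=
    ENNReal.summable_toReal (tsum_minPair (q := q) c ▸ htop)
  have hle : ∀ ℓ, (lengthWeight q ℓ c).toReal ≤ ((q : ℝ)⁻¹) ^ ℓ := fun ℓ => by
    refine (lengthWeight_bounds (a := 0) (b := c ^ ℓ) hqc1
      fun L hL hl => ⟨minWeight_nonneg, (minWeight_le hq hL).trans_eq (by rw [hl])⟩).2.trans ?_
    rw [← hqc, mul_pow]
    gcongr
    exact_mod_cast aCount_le ℓ
  have hzero : (lengthWeight q 0 c).toReal = 0 := by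
    have h := lengthWeight_bounds (q := q) (ℓ := 0) (x := c) (a := 0) (b := 0) hqc1
      fun L hL hl => absurd (List.length_eq_zero_iff.1 hl) hL.1
    simp only [mul_zero] at h
    exact le_antisymm h.2 h.1
  have hsplit : ∑' p : MinPair q, c ^ p.2.1.length =
      ∑ ℓ ∈ Finset.Icc 1 N, (lengthWeight q ℓ c).toReal +
        ∑' ℓ, (lengthWeight q (ℓ + (N + 1)) c).toReal := by
    rw [htsum, ← hsumℓ.sum_add_tsum_nat_add (N + 1), Finset.sum_range_succ', hzero, add_zero,
      show Finset.Icc 1 N = Finset.Ico 1 (N + 1) by ext; simp,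
      Finset.sum_Ico_eq_sum_range]
    simp only [add_tsub_cancel_right, add_comm 1]
  refine ⟨∑' p : MinPair q, c ^ p.2.1.length, ?_, ?_, ?_⟩
  · simp only [instProb3_eq_tsum hq]
    refine tendsto_tsum_of_dominated_convergence hsum (fun p => ?_) (.of_forall fun n p => ?_)
    · refine tendsto_const_nhds.congr' ?_
      filter_upwards [Filter.eventually_gt_atTop (2 * p.2.1.length)] with n hn
      rw [if_pos hn]
    · split_ifs
      · rw [Real.norm_of_nonneg (by positivity)]
      · simp only [norm_zero]; positivity
  · rw [hsplit]
    refine le_add_of_le_of_nonneg (Finset.sum_le_sum fun ℓ _ => ?_)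
      (tsum_nonneg fun _ => ENNReal.toReal_nonneg)
    exact (lengthWeight_bounds hqc1 fun L hL hl => hl ▸ minWeight_bounds hq hL M).1
  · rw [hsplit, add_comm]
    refine add_le_add ?_ (Finset.sum_le_sum fun ℓ _ =>
      (lengthWeight_bounds hqc1 fun L hL hl => hl ▸ minWeight_bounds hq hL M).2)
    have hr0 : (0 : ℝ) ≤ (q : ℝ)⁻¹ := by positivity
    have hr1 : (q : ℝ)⁻¹ < 1 := by linarith
    calc ∑' ℓ, (lengthWeight q (ℓ + (N + 1)) c).toReal
        ≤ ∑' ℓ, ((q : ℝ)⁻¹) ^ ℓ * ((q : ℝ)⁻¹) ^ (N + 1) :=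
          ((summable_nat_add_iff (N + 1)).2 hsumℓ).tsum_le_tsum
            (fun ℓ => (hle _).trans (pow_add _ _ _).le)
            ((summable_geometric_of_lt_one hr0 hr1).mul_right _)
      _ = ((1 - (q : ℝ)⁻¹)⁻¹ * (q : ℝ)⁻¹) * (q : ℝ) ^ (-(N : ℤ)) := by
          rw [tsum_mul_right, tsum_geometric_of_lt_one hr0 hr1, pow_succ', zpow_neg, zpow_natCast,
            inv_pow]
          ring
      _ ≤ 1 * (q : ℝ) ^ (-(N : ℤ)) := by
          gcongr
          rw [inv_mul_le_iff₀ (by linarith)]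
          linarith
      _ = (q : ℝ) ^ (-(N : ℤ)) := one_mul _
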